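/- arXiv:2209.01787 — 2 statements merged into one kernel-verified Lean document; each statement's English description precedes it below -/
import Mathlib

section
/- The number of subsets S of the 4×4 board with |S| = 8 such that both S and its complement are connected equals 140; equivalently, the second gerrymander number (dissections of the 4×4 board into two connected polyominoes of area 8 each) is 70. -/
/-- The grid graph on the `m × n` board: two cells are adjacent when they agree
in one coordinate and differ by exactly 1 in the other. -/
def gridGraph (m n : ℕ) : SimpleGraph (Fin m × Fin n) :=
  SimpleGraph.fromRel (fun a b =>
    (a.1 = b.1 ∧ (a.2 : ℕ) + 1 = (b.2 : ℕ)) ∨ (a.2 = b.2 ∧ (a.1 : ℕ) + 1 = (b.1 : ℕ)))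

/-- A subset of cells is connected if the induced subgraph of the grid graph is
connected (in particular nonempty). -/
def ConnectedRegion (m n : ℕ) (S : Finset (Fin m × Fin n)) : Prop :=
  ((gridGraph m n).induce (S : Set (Fin m × Fin n))).Connected

namespace Gerry

/-- Strict evaluation helper: forces its first argument to a literal in the kernel. -/
def force {α : Type} (n : ℕ) (f : ℕ → α) : α :=
  Nat.rec (f (nat_lit 0)) (fun k _ => f (Nat.succ k)) n

theorem force_eq {α : Type} (n : ℕ) (f : ℕ → α) : force n f = f n := by
  cases n <;> rfl

/-- One flood-fill step of `x` inside the mask `m`. -/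
def step (m x : ℕ) : ℕ :=
  Nat.land m (Nat.lor x (Nat.lor (Nat.shiftLeft x (nat_lit 4)) (Nat.lor (Nat.shiftRight (Nat.land x (nat_lit 65520)) (nat_lit 4))
    (Nat.lor (Nat.shiftLeft (Nat.land x (nat_lit 30583)) (nat_lit 1)) (Nat.shiftRight (Nat.land x (nat_lit 61166)) (nat_lit 1))))))

def iter (m k : ℕ) : ℕ → ℕ :=
  Nat.rec (fun x => x) (fun _ ih x => force (step m x) ih) k

def fill (m : ℕ) : ℕ := iter m (nat_lit 7) (Nat.pow (nat_lit 2) (Nat.log2 m))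

def bit (m i : ℕ) : ℕ := Nat.mod (Nat.shiftRight m i) (nat_lit 2)

def pop (m : ℕ) : ℕ :=
  Nat.add (Nat.add (Nat.add (Nat.add (bit m (nat_lit 0)) (bit m (nat_lit 1))) (Nat.add (bit m (nat_lit 2)) (bit m (nat_lit 3))))
      (Nat.add (Nat.add (bit m (nat_lit 4)) (bit m (nat_lit 5))) (Nat.add (bit m (nat_lit 6)) (bit m (nat_lit 7)))))
    (Nat.add (Nat.add (Nat.add (bit m (nat_lit 8)) (bit m (nat_lit 9))) (Nat.add (bit m (nat_lit 10)) (bit m (nat_lit 11))))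
      (Nat.add (Nat.add (bit m (nat_lit 12)) (bit m (nat_lit 13))) (Nat.add (bit m (nat_lit 14)) (bit m (nat_lit 15)))))

/-- connectedness test -/
def conn (m : ℕ) : Bool := Nat.beq (fill m) m

def good (m : ℕ) : Bool :=
  cond (Nat.beq (pop m) (nat_lit 8)) (cond (conn m) (conn (Nat.sub (nat_lit 65535) m)) false) false

/-- the flood fill has not stabilised -/
def bad (m : ℕ) : Bool :=
  cond (Nat.beq (pop m) (nat_lit 8))
    (force (fill m) fun f => cond (Nat.beq (step m f) f) false true) false

def cnt (P : ℕ → Bool) (k : ℕ) : ℕ → ℕ :=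
  Nat.rec (fun a => cond (P a) (nat_lit 1) (nat_lit 0))
    (fun _ ih a => Nat.add (force (Nat.mul (nat_lit 2) a) ih) (force (Nat.add (Nat.mul (nat_lit 2) a) (nat_lit 1)) ih)) k

theorem cnt_good : cnt good 16 0 = 140 := by decide +kernel
theorem cnt_bad : cnt bad 16 0 = 0 := by decide +kernel

theorem cnt_eq (P : ℕ → Bool) (k a : ℕ) :
    cnt P k a = ((Finset.Ico (a * 2 ^ k) ((a + 1) * 2 ^ k)).filter (fun m => P m = true)).card := by
  induction k generalizing a with
  | zero =>
    simp only [pow_zero, mul_one, Nat.Ico_succ_singleton, Finset.filter_singleton]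
    show cond (P a) 1 0 = _
    cases h : P a <;> simp
  | succ k ih =>
    have h1 : cnt P (k + 1) a = cnt P k (2 * a) + cnt P k (2 * a + 1) := by
      show force (2 * a) (cnt P k) + force (2 * a + 1) (cnt P k) = _
      rw [force_eq, force_eq]
    rw [h1, ih, ih, ← Finset.card_union_of_disjoint, ← Finset.filter_union,
      Finset.Ico_union_Ico_eq_Ico]
    · congr 2
      congr 1 <;> ring
    · gcongr; omega
    · gcongr; omega
    · apply Finset.disjoint_filter_filter
      exact Finset.Ico_disjoint_Ico_consecutive _ _ _

def idx (p : Fin 4 × Fin 4) : ℕ := 4 * p.1.val + p.2.val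

theorem idx_lt (p : Fin 4 × Fin 4) : idx p < 16 := by
  unfold idx; omega

theorem idx_surj (i : ℕ) (h : i < 16) : ∃ p, idx p = i :=
  ⟨(⟨i / 4, by omega⟩, ⟨i % 4, by omega⟩), by simp only [idx]; omega⟩

def D (m : ℕ) : Finset (Fin 4 × Fin 4) := Finset.univ.filter (fun p => m.testBit (idx p) = true)

theorem mem_D (m p) : p ∈ D m ↔ m.testBit (idx p) = true := by simp [D]

set_option maxHeartbeats 2000000 in
theorem step_spec (m x : ℕ) (p : Fin 4 × Fin 4) :
    (step m x).testBit (idx p) = true ↔ m.testBit (idx p) = true ∧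
      (x.testBit (idx p) = true ∨ ∃ q, (gridGraph 4 4).Adj q p ∧ x.testBit (idx q) = true) := by
  have e : step m x = m &&& (x ||| (x <<< 4 ||| ((x &&& 65520) >>> 4 |||
    ((x &&& 30583) <<< 1 ||| (x &&& 61166) >>> 1)))) := rfl
  rw [e]
  have c1 : ∀ i, i < 20 → (Nat.testBit 65520 i = decide (4 ≤ i ∧ i < 16)) := by decide
  have c2 : ∀ i, i < 20 → (Nat.testBit 30583 i = decide (i % 4 ≠ 3 ∧ i < 16)) := by decide
  have c3 : ∀ i, i < 20 → (Nat.testBit 61166 i = decide (i % 4 ≠ 0 ∧ i < 16)) := by decide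
  obtain ⟨a, b⟩ := p
  fin_cases a <;> fin_cases b <;>
    simp [idx, gridGraph, Prod.exists, Fin.exists_fin_succ,  Nat.testBit_shiftLeft, Nat.testBit_shiftRight, c1, c2, c3] <;> tauto

theorem pop_spec (m : ℕ) : (D m).card = pop m := by
  have hb : ∀ i, bit m i = if m.testBit i = true then 1 else 0 := by
    intro i
    show (m >>> i) % 2 = _
    rw [Nat.testBit_eq_decide_div_mod_eq, Nat.shiftRight_eq_div_pow]
    rcases Nat.mod_two_eq_zero_or_one (m / 2 ^ i) with h | h <;> simp [h]
  have pop' : pop m =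
      (bit m 0 + bit m 1 + (bit m 2 + bit m 3)) + (bit m 4 + bit m 5 + (bit m 6 + bit m 7))
      + ((bit m 8 + bit m 9 + (bit m 10 + bit m 11))
        + (bit m 12 + bit m 13 + (bit m 14 + bit m 15))) :=
    rfl
  rw [D, Finset.card_filter, Fintype.sum_prod_type]
  have hi : ∀ (b : Bool) [Decidable (b = true)], (if b = true then 1 else 0) = b.toNat := by
    intro b _; cases b <;> simp
  simp only [hi]
  simp only [Fin.sum_univ_four, pop', hb, idx, hi]
  simp [-Nat.testBit_zero]
  ring

theorem iter_inv (m : ℕ) (Q : ℕ → Prop) (hQ : ∀ x, Q x → Q (step m x)) (k : ℕ) :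
    ∀ x, Q x → Q (iter m k x) := by
  induction k with
  | zero => intro x h; exact h
  | succ k ih =>
    intro x h
    show Q (force (step m x) (iter m k))
    rw [force_eq]
    exact ih _ (hQ _ h)

theorem conn_spec (m : ℕ) (h0 : m ≠ 0) (hm : m < 65536) (hf : step m (fill m) = fill m) :
    ConnectedRegion 4 4 (D m) ↔ conn m = true := by
  have hroot : m.testBit m.log2 = true := Nat.testBit_log2 h0
  have hlog : m.log2 < 16 := (Nat.log2_lt h0).2 (by simpa using hm)
  obtain ⟨r, hr⟩ := idx_surj _ hlog
  have hrD : r ∈ D m := by rw [mem_D, hr, hroot]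
  have hstart : ∀ i, (Nat.pow 2 m.log2).testBit i = decide (m.log2 = i) := fun i =>
    Nat.testBit_two_pow
  have hinj : ∀ p q, idx p = idx q → p = q := by
    unfold idx
    rintro ⟨a, b⟩ ⟨c, d⟩ h
    simp only at h
    ext <;> simp only <;> omega
  have hc : conn m = true ↔ fill m = m := by unfold conn; exact Nat.beq_eq ▸ Iff.rfl
  rw [hc]
  constructor
  · intro hcon
    have hroot' : (fill m).testBit (idx r) = true := by
      apply iter_inv m (fun x => x.testBit (idx r) = true)
      · intro x hx
        rw [step_spec]
        exact ⟨(mem_D _ _).1 hrD, Or.inl hx⟩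
      · rw [hstart]; simp [hr]
    have key : ∀ q : (D m : Set (Fin 4 × Fin 4)), (fill m).testBit (idx q.1) = true := by
      intro q
      have hre := hcon.preconnected ⟨r, hrD⟩ q
      rw [SimpleGraph.reachable_iff_reflTransGen] at hre
      induction hre with
      | refl => exact hroot'
      | @tail b c _ hbc ih =>
        rw [← hf, step_spec]
        exact ⟨(mem_D _ _).1 c.2, Or.inr ⟨b.1, hbc, ih⟩⟩
    have hsub : ∀ i, (fill m).testBit i = true → m.testBit i = true := by
      intro i hi
      rw [← hf] at hi
      have : (m &&& _).testBit i = true := hi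
      rw [Nat.testBit_land, Bool.and_eq_true] at this
      exact this.1
    apply Nat.eq_of_testBit_eq
    intro i
    rw [Bool.eq_iff_iff]
    refine ⟨hsub i, fun hi => ?_⟩
    have hi16 : i < 16 := by
      by_contra hge
      have : m.testBit i = false := Nat.testBit_lt_two_pow
        (lt_of_lt_of_le hm (by
          have := Nat.pow_le_pow_right (n := 2) (by norm_num) (not_lt.1 hge)
          simpa using this))
      simp [this] at hi
    obtain ⟨p, rfl⟩ := idx_surj i hi16
    exact key ⟨p, (mem_D _ _).2 hi⟩
  · intro hfm
    have key : ∀ p, (fill m).testBit (idx p) = true → ∃ h : p ∈ D m,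
        ((gridGraph 4 4).induce (D m : Set (Fin 4 × Fin 4))).Reachable ⟨r, hrD⟩ ⟨p, h⟩ := by
      apply iter_inv m (fun x => ∀ p, x.testBit (idx p) = true → ∃ h : p ∈ D m,
        ((gridGraph 4 4).induce (D m : Set (Fin 4 × Fin 4))).Reachable ⟨r, hrD⟩ ⟨p, h⟩)
      · intro x hx p hp
        rw [step_spec] at hp
        obtain ⟨h1, h2 | ⟨q, hq, h2⟩⟩ := hp
        · exact hx p h2
        · obtain ⟨hqD, hre⟩ := hx q h2
          refine ⟨(mem_D _ _).2 h1, hre.trans (SimpleGraph.Adj.reachable ?_)⟩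
          exact hq
      · intro p hp
        rw [hstart] at hp
        have : r = p := hinj _ _ (by rw [hr]; simpa using hp)
        subst this
        exact ⟨hrD, SimpleGraph.Reachable.refl _⟩
    have hall : ∀ p : (D m : Set (Fin 4 × Fin 4)),
        ((gridGraph 4 4).induce (D m : Set (Fin 4 × Fin 4))).Reachable ⟨r, hrD⟩ p := by
      rintro ⟨p, hp⟩
      exact (key p (by rw [hfm]; exact (mem_D _ _).1 hp)).2
    have : Nonempty (D m : Set (Fin 4 × Fin 4)) := ⟨⟨r, hrD⟩⟩
    exact SimpleGraph.Connected.mk (fun u v => (hall u).symm.trans (hall v))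

theorem D_compl (m : ℕ) (hm : m < 65536) : (D m)ᶜ = D (65535 - m) := by
  ext p
  rw [Finset.mem_compl, mem_D, mem_D]
  have h : (65535 - m : ℕ) = 2 ^ 16 - (m + 1) := by omega
  rw [h, Nat.testBit_two_pow_sub_succ (by simpa using hm)]
  simp [idx_lt]

theorem D_inj : ∀ m < 65536, ∀ n < 65536, D m = D n → m = n := by
  intro m hm n hn h
  apply Nat.eq_of_testBit_eq
  intro i
  by_cases hi : i < 16
  · obtain ⟨p, rfl⟩ := idx_surj i hi
    have := congrArg (fun S => p ∈ S) h
    simp only [mem_D, eq_iff_iff] at this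
    rwa [Bool.eq_iff_iff]
  · have h2 := Nat.pow_le_pow_right (n := 2) (by norm_num) (not_lt.1 hi)
    rw [Nat.testBit_lt_two_pow (lt_of_lt_of_le hm (by simpa using h2)),
      Nat.testBit_lt_two_pow (lt_of_lt_of_le hn (by simpa using h2))]

theorem D_surj (S : Finset (Fin 4 × Fin 4)) : ∃ m, m < 65536 ∧ D m = S := by
  have hb : Function.Bijective (fun m : Fin 65536 => D m.val) := by
    rw [Fintype.bijective_iff_injective_and_card]
    refine ⟨fun a b h => Fin.ext (D_inj _ a.2 _ b.2 h), ?_⟩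
    rw [Fintype.card_fin, Fintype.card_finset, Fintype.card_prod, Fintype.card_fin]
    norm_num
  obtain ⟨m, hm⟩ := hb.2 S
  exact ⟨m, m.2, hm⟩

theorem stable (m : ℕ) (hm : m < 65536) (hp : pop m = 8) : step m (fill m) = fill m := by
  have h := cnt_bad
  rw [cnt_eq, Finset.card_eq_zero, Finset.filter_eq_empty_iff] at h
  have h2 := h (x := m) (by simpa using hm)
  unfold bad at h2
  rw [force_eq, hp] at h2
  by_contra hne
  apply h2
  have : Nat.beq (step m (fill m)) (fill m) = false := by
    rw [Bool.eq_false_iff]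
    intro h; exact hne (Nat.eq_of_beq_eq_true h)
  rw [this]
  rfl

theorem pop_zero : pop 0 = 0 := by decide

theorem good_spec (m : ℕ) (hm : m < 65536) :
    ((D m).card = 8 ∧ ConnectedRegion 4 4 (D m) ∧ ConnectedRegion 4 4 (D m)ᶜ) ↔
      good m = true := by
  rw [pop_spec]
  by_cases hp : pop m = 8
  · have hp2 : pop (65535 - m) = 8 := by
      rw [← pop_spec, ← D_compl m hm, Finset.card_compl, pop_spec, hp]
      simp
    have hne : ∀ n, pop n = 8 → n ≠ 0 := by
      rintro n h rfl
      rw [pop_zero] at h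
      omega
    rw [D_compl m hm, conn_spec m (hne _ hp) hm (stable m hm hp),
      conn_spec (65535 - m) (hne _ hp2) (by omega) (stable _ (by omega) hp2)]
    unfold good
    rw [hp]
    show _ ↔ (cond (conn m) (conn (65535 - m)) false) = true
    cases conn m <;> simp
  · have : Nat.beq (pop m) 8 = false := by
      rw [Bool.eq_false_iff]
      intro h; exact hp (Nat.eq_of_beq_eq_true h)
    unfold good
    rw [this]
    simp [hp]

end Gerry

/-- The number of subsets `S` of the 4×4 board with `|S| = 8` such that both
`S` and its complement are connected equals 140; equivalently, the
gerrymander number (dissections into two connected polyominoes of equal area)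
for this board is half of that. -/
theorem gerrymander_count_4x4 :
    Nat.card {S : Finset (Fin 4 × Fin 4) //
      S.card = 8 ∧ ConnectedRegion 4 4 S ∧ ConnectedRegion 4 4 Sᶜ} = 140 := by
  classical
  rw [← Gerry.cnt_good, Gerry.cnt_eq, Nat.card_eq_fintype_card, Fintype.card_subtype]
  symm
  apply Finset.card_bij (fun m _ => Gerry.D m)
  · intro m hm
    rw [Finset.mem_filter, Finset.mem_Ico] at hm
    rw [Finset.mem_filter]
    exact ⟨Finset.mem_univ _, (Gerry.good_spec m (by omega)).2 hm.2⟩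
  · intro a ha b hb h
    rw [Finset.mem_filter, Finset.mem_Ico] at ha hb
    exact Gerry.D_inj a (by omega) b (by omega) h
  · intro S hS
    rw [Finset.mem_filter] at hS
    obtain ⟨m, hm, rfl⟩ := Gerry.D_surj S
    refine ⟨m, ?_, rfl⟩
    rw [Finset.mem_filter, Finset.mem_Ico]
    exact ⟨by omega, (Gerry.good_spec m hm).1 hS.2⟩
end

section
/- The number of subsets S of the 6×6 board with |S| = 18 such that both S and its complement are connected equals 161036; equivalently, the third gerrymander number (dissections of the 6×6 board into two connected polyominoes of area 18 each) is 80518. -/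
namespace GM

/-- Evaluate a natural number before passing it to a continuation. -/
noncomputable def force {α : Type} (n : ℕ) (K : ℕ → α) : α :=
  Nat.rec (K 0) (fun m _ => K (Nat.succ m)) n

theorem force_eq {α : Type} (n : ℕ) (K : ℕ → α) : force n K = K n := by
  cases n <;> rfl

/-- Label of the slot of the packed state `s` at the power `p` of 32. -/
noncomputable def lab (s p : ℕ) : ℕ := Nat.mod (Nat.div s p) (nat_lit 32)

/-- Finished colour of the packed state `s`. -/
noncomputable def dead (s : ℕ) : ℕ := Nat.div s (nat_lit 1073741824)

/-- Position of the first occurrence. -/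
noncomputable def idx (l : List ℕ) (x : ℕ) : ℕ :=
  List.rec (nat_lit 0) (fun a _ ih => Bool.rec (Nat.succ ih) (nat_lit 0) (Nat.beq a x)) l

/-- Boolean membership. -/
noncomputable def mem (l : List ℕ) (x : ℕ) : Bool :=
  List.rec false (fun a _ ih => Bool.rec ih true (Nat.beq a x)) l

/-- Does some label of the list have colour `x`? -/
noncomputable def memCol (l : List ℕ) (x : ℕ) : Bool :=
  List.rec false (fun a _ ih => Bool.rec ih true (Nat.beq (Nat.mod a (nat_lit 3)) x)) l

/-- Pack the canonical relabelling of a list (relative to `n`), ending with `d`. -/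
noncomputable def enc (n : List ℕ) (d : ℕ) (l : List ℕ) : ℕ :=
  List.rec d (fun a _ ih => Nat.add (Nat.add (Nat.mul (nat_lit 3) (idx n a)) (Nat.mod a (nat_lit 3)))
    (Nat.mul (nat_lit 32) ih)) l

/-- Merge: the new label if `x` is the class of the upper or left neighbour of the same colour. -/
noncomputable def mrg (f : Bool) (b u lf x : ℕ) : ℕ :=
  Bool.rec (Bool.rec x (Bool.rec x (Bool.rec x (Nat.add (nat_lit 18) b) (Nat.beq x lf))
      (Nat.beq (Nat.mod lf (nat_lit 3)) b)) f)
    (Bool.rec (Bool.rec x (Bool.rec x (Bool.rec x (Nat.add (nat_lit 18) b) (Nat.beq x lf))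
      (Nat.beq (Nat.mod lf (nat_lit 3)) b)) f)
      (Nat.add (nat_lit 18) b) (Nat.beq x u)) (Nat.beq (Nat.mod u (nat_lit 3)) b)

/-- Finish a step: `m` is the label of the slot which is dropped, `n` the new labels. -/
noncomputable def fin (d u m : ℕ) (n : List ℕ) : Option ℕ :=
  Bool.rec (Bool.rec (some (enc n (Bool.rec (Nat.mod u (nat_lit 3)) d
      (Nat.beq (Nat.mod u (nat_lit 3)) (nat_lit 2))) n))
    none (memCol n (Nat.mod u (nat_lit 3)))) (some (enc n d n)) (mem n m)

/-- One step of the automaton: add a cell of colour `b`;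
`f` says whether it has a left neighbour. -/
noncomputable def step (f : Bool) (s b : ℕ) : Option ℕ :=
  Bool.rec (
  force (lab s (nat_lit 1)) fun u => force (lab s (nat_lit 33554432)) fun lf =>
  force (mrg f b u lf u) fun m0 =>
  force (mrg f b u lf (lab s (nat_lit 32))) fun m1 =>
  force (mrg f b u lf (lab s (nat_lit 1024))) fun m2 =>
  force (mrg f b u lf (lab s (nat_lit 32768))) fun m3 =>
  force (mrg f b u lf (lab s (nat_lit 1048576))) fun m4 =>
  force (mrg f b u lf lf) fun m5 => force (Nat.add (nat_lit 18) b) fun fr =>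
  fin (dead s) u m0 [m1, m2, m3, m4, m5, fr]) none (Nat.beq b (dead s))

/-- Acceptance of two labels: same colour only if same label. -/
noncomputable def ok (x y : ℕ) : Bool := bif Nat.beq (x % 3) (y % 3) then Nat.beq x y else true

/-- Acceptance condition on a label list. -/
noncomputable def okAll (x : ℕ) : List ℕ → Bool
  | [] => true
  | a :: l => ok x a && okAll x l

/-- Acceptance condition on all pairs. -/
noncomputable def okPairs : List ℕ → Bool
  | [] => true
  | a :: l => okAll a l && okPairs l

/-- Final acceptance. -/
noncomputable def acc (s : ℕ) : Bool :=
  okPairs [lab s (nat_lit 1), lab s (nat_lit 32), lab s (nat_lit 1024), lab s (nat_lit 32768), lab s (nat_lit 1048576), lab s (nat_lit 33554432)]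

/-- Search trees from states to weights. -/
inductive Tr where
  | leaf : Tr
  | node (l : Tr) (k v : ℕ) (r : Tr) : Tr

/-- Insertion in continuation passing style. -/
noncomputable def ins (t : Tr) (k v : ℕ) : (Tr → ℕ) → ℕ :=
  Tr.rec (fun K => K (.node .leaf k v .leaf))
    (fun l k' v' r il ir K =>
      Bool.rec (Bool.rec (ir fun r' => K (.node l k' v' r')) (il fun l' => K (.node l' k' v' r))
        (Nat.ble k k')) (force (Nat.add v' v) fun v'' => K (.node l k' v'' r)) (Nat.beq k k')) t

/-- Insert the result of a step. -/
noncomputable def put (o : Option ℕ) (v : ℕ) (t : Tr) (K : Tr → ℕ) : ℕ :=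
  Option.rec (K t) (fun s => force s fun s => force v fun v => ins t s v K) o

/-- The weight of a cell of colour one. -/
noncomputable def X : ℕ := nat_lit 1099511627776

/-- All steps from all states of a tree. -/
noncomputable def expand (f : Bool) (t : Tr) : Tr → (Tr → ℕ) → ℕ :=
  Tr.rec (fun a K => K a)
    (fun _ k v _ il ir a K =>
      put (step f k (nat_lit 0)) v a fun a =>
        put (step f k (nat_lit 1)) (Nat.mul v X) a fun a => il a fun a => ir a K) t

/-- Sum of the accepted weights. -/
noncomputable def total : Tr → ℕ
  | .leaf => 0
  | .node l k v r => total l + (bif acc k then v else 0) + total r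

/-- Does the next cell (with `n` cells before the step still to be added) have a left neighbour? -/
noncomputable def flag (n : ℕ) : Bool := ! Nat.beq (n % 6) 0

/-- The whole computation, `n` cells remaining. -/
noncomputable def run : ℕ → Tr → ℕ
  | 0, t => total t
  | n + 1, t => expand (flag (n + 1)) t .leaf fun t' => run n t'

/-- The initial state: six virtual cells of colour 2. -/
noncomputable def s0 : ℕ := enc [2, 2, 2, 2, 2, 2] 2 [2, 2, 2, 2, 2, 2]

theorem computation :
    Nat.beq (run 36 (.node .leaf s0 1 .leaf) / X ^ 18 % X) 161036 = true := by
  decide +kernel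

/-! ### The connectivity relation -/

/-- `R c n x y`: cells `x`, `y` are connected inside their colour class, using only the
first `n + 6` cells (the first six are virtual and connected to each other). -/
def R (c : ℕ → ℕ) : ℕ → ℕ → ℕ → Prop
  | 0, x, y => x = y ∨ (x < 6 ∧ y < 6)
  | n + 1, x, y => R c n x y ∨
      ((x = n + 6 ∨ (c n = c (n + 6) ∧ R c n x n) ∨
          (n % 6 ≠ 0 ∧ c (n + 5) = c (n + 6) ∧ R c n x (n + 5))) ∧
       (y = n + 6 ∨ (c n = c (n + 6) ∧ R c n y n) ∨
          (n % 6 ≠ 0 ∧ c (n + 5) = c (n + 6) ∧ R c n y (n + 5))))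

/-- The component of the new cell `n + 6`. -/
def T (c : ℕ → ℕ) (n x : ℕ) : Prop :=
  x = n + 6 ∨ (c n = c (n + 6) ∧ R c n x n) ∨
    (n % 6 ≠ 0 ∧ c (n + 5) = c (n + 6) ∧ R c n x (n + 5))

theorem R_succ (c : ℕ → ℕ) (n x y : ℕ) :
    R c (n + 1) x y ↔ R c n x y ∨ (T c n x ∧ T c n y) := Iff.rfl

theorem R_basic (c : ℕ → ℕ) (n : ℕ) :
    (∀ x, R c n x x) ∧ (∀ x y, R c n x y → R c n y x) ∧
    (∀ x y z, R c n x y → R c n y z → R c n x z) ∧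
    (∀ x y, R c n x y → x = y ∨ (x < n + 6 ∧ y < n + 6)) := by
  induction n with
  | zero =>
    refine ⟨fun x => Or.inl rfl, ?_, ?_, ?_⟩
    · intro x y h; simp only [R] at *; omega
    · intro x y z h1 h2; simp only [R] at *; omega
    · intro x y h; simp only [R] at *; omega
  | succ n ih =>
    obtain ⟨h1, h2, h3, h4⟩ := ih
    have hT : ∀ x y, R c n x y → T c n x → T c n y := by
      rintro x y h (hx | ⟨hx, hx'⟩ | ⟨hx, hx', hx''⟩)
      · rcases h4 x y h with h | h
        · left; omega
        · omega
      · right; left; exact ⟨hx, h3 _ _ _ (h2 _ _ h) hx'⟩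
      · right; right; exact ⟨hx, hx', h3 _ _ _ (h2 _ _ h) hx''⟩
    have hT' : ∀ x, T c n x → x < n + 7 := by
      rintro x (hx | ⟨hx, hx'⟩ | ⟨hx, hx', hx''⟩)
      · omega
      · have := h4 _ _ hx'; omega
      · have := h4 _ _ hx''; omega
    refine ⟨fun x => Or.inl (h1 x), ?_, ?_, ?_⟩
    · intro x y h
      rw [R_succ] at *
      exact h.imp (h2 _ _) And.symm
    · intro x y z h h'
      rw [R_succ] at *
      rcases h with h | h <;> rcases h' with h' | h'
      · exact Or.inl (h3 _ _ _ h h')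
      · exact Or.inr ⟨hT _ _ (h2 _ _ h) h'.1, h'.2⟩
      · exact Or.inr ⟨h.1, hT _ _ h' h.2⟩
      · exact Or.inr ⟨h.1, h'.2⟩
    · intro x y h
      rw [R_succ] at h
      rcases h with h | h
      · have := h4 _ _ h; omega
      · have := hT' _ h.1; have := hT' _ h.2; omega

theorem R_refl (c : ℕ → ℕ) (n x : ℕ) : R c n x x := (R_basic c n).1 x

theorem R_symm {c : ℕ → ℕ} {n x y : ℕ} (h : R c n x y) : R c n y x := (R_basic c n).2.1 _ _ h

theorem R_trans {c : ℕ → ℕ} {n x y z : ℕ} (h : R c n x y) (h' : R c n y z) : R c n x z :=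
  (R_basic c n).2.2.1 _ _ _ h h'

theorem R_lt {c : ℕ → ℕ} {n x y : ℕ} (h : R c n x y) : x = y ∨ (x < n + 6 ∧ y < n + 6) :=
  (R_basic c n).2.2.2 _ _ h

theorem R_mono {c : ℕ → ℕ} {n x y : ℕ} (m : ℕ) (h : R c n x y) : R c (n + m) x y := by
  induction m with
  | zero => exact h
  | succ m ih => exact Or.inl ih

theorem T_closed {c : ℕ → ℕ} {n x y : ℕ} (h : R c n x y) (hx : T c n x) : T c n y := by
  have h1 : R c (n + 1) y (n + 6) := R_trans (R_symm (Or.inl h)) ((R_succ ..).2 (Or.inr ⟨hx, Or.inl rfl⟩))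
  rcases (R_succ ..).1 h1 with h2 | h2
  · rcases R_lt h2 with h3 | h3
    · exact Or.inl h3
    · omega
  · exact h2.1

/-- Minimality of the connectivity relation. -/
theorem R_min (c : ℕ → ℕ) (Q : ℕ → ℕ → Prop) (hr : ∀ x, Q x x) (hs : ∀ x y, Q x y → Q y x)
    (ht : ∀ x y z, Q x y → Q y z → Q x z) (h0 : ∀ x y, x < 6 → y < 6 → Q x y) (N : ℕ)
    (h1 : ∀ n, n < N → c n = c (n + 6) → Q n (n + 6))
    (h2 : ∀ n, n < N → n % 6 ≠ 0 → c (n + 5) = c (n + 6) → Q (n + 5) (n + 6))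
    (n : ℕ) (hn : n ≤ N) (x y : ℕ) (h : R c n x y) : Q x y := by
  induction n generalizing x y with
  | zero =>
    rcases h with h | h
    · exact h ▸ hr x
    · exact h0 _ _ h.1 h.2
  | succ n ih =>
    have ih := ih (by omega)
    have key : ∀ x, T c n x → Q x (n + 6) := by
      rintro x (hx | ⟨hx, hx'⟩ | ⟨hx, hx', hx''⟩)
      · exact hx ▸ hr x
      · exact ht _ _ _ (ih _ _ hx') (h1 n (by omega) hx)
      · exact ht _ _ _ (ih _ _ hx'') (h2 n (by omega) hx hx')
    rcases (R_succ ..).1 h with h | h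
    · exact ih _ _ h
    · exact ht _ _ _ (key _ h.1) (hs _ _ (key _ h.2))

/-- Admissible colourings: colour 2 exactly on the virtual cells. -/
def Adm (c : ℕ → ℕ) : Prop := (∀ x, x < 6 → c x = 2) ∧ ∀ x, 6 ≤ x → c x < 2

theorem R_col {c : ℕ → ℕ} (hc : Adm c) {n x y : ℕ} (h : R c n x y) : c x = c y := by
  refine R_min c (fun x y => c x = c y) (fun _ => rfl) (fun _ _ h => h.symm)
    (fun _ _ _ h h' => h.trans h') ?_ n (fun _ _ h => h) (fun _ _ _ h => h) n le_rfl x y h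
  intro x y hx hy
  rw [hc.1 x hx, hc.1 y hy]

theorem R_two {c : ℕ → ℕ} (hc : Adm c) {n x y : ℕ} (hx : c x = 2) (hy : c y = 2) : R c n x y := by
  have hx' : x < 6 := by
    by_contra h
    have := hc.2 x (by omega)
    omega
  have hy' : y < 6 := by
    by_contra h
    have := hc.2 y (by omega)
    omega
  have : R c (0 + n) x y := R_mono n (Or.inr ⟨hx', hy'⟩)
  simpa using this

/-- A component without a frontier cell does not grow any more. -/
theorem R_dead {c : ℕ → ℕ} {n x : ℕ} (hx : x < n + 6) (h : ∀ i, i < 6 → ¬ R c n x (n + i)) (m : ℕ) :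
    (∀ i, i < 6 → ¬ R c (n + m) x (n + m + i)) ∧ ∀ y, R c (n + m) x y → R c n x y := by
  induction m with
  | zero => exact ⟨h, fun y h => h⟩
  | succ m ih =>
    obtain ⟨ih1, ih2⟩ := ih
    have hT : ¬ T c (n + m) x := by
      rintro (h | h | h)
      · omega
      · exact ih1 0 (by omega) h.2
      · exact ih1 5 (by omega) h.2.2
    have hR : ∀ y, R c (n + (m + 1)) x y → R c (n + m) x y := by
      intro y h
      rcases (R_succ ..).1 h with h | h
      · exact h
      · exact absurd h.1 hT
    refine ⟨?_, fun y h => ih2 y (hR y h)⟩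
    intro i hi h
    have h := hR _ h
    by_cases h5 : i = 5
    · rcases R_lt h with h' | h' <;> omega
    · refine ih1 (i + 1) (by omega) ?_
      have e : n + m + (i + 1) = n + (m + 1) + i := by omega
      rwa [e]

/-! ### The automaton -/

/-- Label of slot `i`. -/
def lb (s i : ℕ) : ℕ := s / 32 ^ i % 32

theorem beq_false' {a x : ℕ} (h : a ≠ x) : Nat.beq a x = false := by
  rw [← Bool.not_eq_true, Nat.beq_eq]
  exact h

theorem idx_cons (a : ℕ) (l : List ℕ) (x : ℕ) :
    idx (a :: l) x = if a = x then 0 else idx l x + 1 := by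
  have : idx (a :: l) x = Bool.rec (Nat.succ (idx l x)) 0 (Nat.beq a x) := rfl
  rw [this]
  by_cases h : a = x
  · simp [h]
  · rw [beq_false' h, if_neg h]

theorem idx_get (l : List ℕ) (x : ℕ) (h : x ∈ l) : idx l x < l.length ∧ l.getD (idx l x) 0 = x := by
  induction l with
  | nil => simp at h
  | cons a l ih =>
    rw [idx_cons]
    by_cases hx : a = x
    · simp [hx]
    · have := ih (by simpa [Ne.symm hx] using h)
      simpa [hx] using this

theorem mem_iff (l : List ℕ) (x : ℕ) : mem l x = true ↔ x ∈ l := by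
  induction l with
  | nil => simp [mem]
  | cons a l ih =>
    have : mem (a :: l) x = Bool.rec (mem l x) true (Nat.beq a x) := rfl
    rw [this]
    by_cases h : a = x
    · simp [h]
    · rw [beq_false' h]; simp [Ne.symm h, ih]

theorem memCol_iff (l : List ℕ) (x : ℕ) : memCol l x = true ↔ ∃ a ∈ l, a % 3 = x := by
  induction l with
  | nil => simp [memCol]
  | cons a l ih =>
    have : memCol (a :: l) x = Bool.rec (memCol l x) true (Nat.beq (a % 3) x) := rfl
    rw [this]
    by_cases h : a % 3 = x
    · simp [h]
    · rw [beq_false' h]; simp [h, ih]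

theorem enc_cons (n : List ℕ) (d a : ℕ) (l : List ℕ) :
    enc n d (a :: l) = (3 * idx n a + a % 3) + 32 * enc n d l := rfl

theorem lb_enc (n : List ℕ) (d : ℕ) (l : List ℕ) (hn : n.length ≤ 9) (h : ∀ a ∈ l, a ∈ n) (i : ℕ)
    (hi : i < l.length) : lb (enc n d l) i = 3 * idx n (l.getD i 0) + l.getD i 0 % 3 := by
  induction l generalizing i with
  | nil => simp at hi
  | cons a l ih =>
    have h1 := (idx_get n a (h a (by simp))).1
    rw [enc_cons]
    cases i with
    | zero => simp [lb]; omega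
    | succ i =>
      have := ih (fun b hb => h b (by simp [hb])) i (by simpa using hi)
      have e : lb (3 * idx n a + a % 3 + 32 * enc n d l) (i + 1) = lb (enc n d l) i := by
        unfold lb
        rw [pow_succ', ← Nat.div_div_eq_div_mul]
        congr 2
        omega
      rw [e, this]
      simp

theorem dead_enc (n : List ℕ) (d : ℕ) (l : List ℕ) (hn : n.length ≤ 9) (h : ∀ a ∈ l, a ∈ n) :
    enc n d l / 32 ^ l.length = d := by
  induction l with
  | nil => simp [enc]
  | cons a l ih =>
    have h1 := (idx_get n a (h a (by simp))).1
    have := ih (fun b hb => h b (by simp [hb]))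
    rw [enc_cons, List.length_cons, pow_succ', ← Nat.div_div_eq_div_mul]
    have e : (3 * idx n a + a % 3 + 32 * enc n d l) / 32 = enc n d l := by omega
    rw [e, this]

theorem dead_eq (s : ℕ) : dead s = s / 32 ^ 6 := rfl

theorem mrg_eq (f : Bool) (b u lf x : ℕ) : mrg f b u lf x =
    if (u % 3 = b ∧ x = u) ∨ (f = true ∧ lf % 3 = b ∧ x = lf) then 18 + b else x := by
  have : mrg f b u lf x = bif (Nat.beq (u % 3) b && Nat.beq x u) ||
      (f && (Nat.beq (lf % 3) b && Nat.beq x lf)) then 18 + b else x := by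
    unfold mrg
    change (Bool.rec (Bool.rec x (Bool.rec x (Bool.rec x (18 + b) (Nat.beq x lf))
      (Nat.beq (lf % 3) b)) f)
      (Bool.rec (Bool.rec x (Bool.rec x (Bool.rec x (18 + b) (Nat.beq x lf))
      (Nat.beq (lf % 3) b)) f)
      (18 + b) (Nat.beq x u)) (Nat.beq (u % 3) b) : ℕ) = _
    cases Nat.beq (u % 3) b <;> cases Nat.beq x u <;> cases f <;> cases Nat.beq (lf % 3) b <;>
      cases Nat.beq x lf <;> rfl
  rw [this]
  simp [cond_eq_ite]

theorem fin_eq (d u m : ℕ) (n : List ℕ) : fin d u m n =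
    if m ∈ n then some (enc n d n) else if ∃ a ∈ n, a % 3 = u % 3 then none
    else some (enc n (if u % 3 = 2 then d else u % 3) n) := by
  have : fin d u m n = bif mem n m then some (enc n d n)
      else bif memCol n (u % 3) then none
      else some (enc n (bif Nat.beq (u % 3) 2 then d else u % 3) n) := by
    unfold fin
    change (Bool.rec (Bool.rec (some (enc n (Bool.rec (u % 3) d
      (Nat.beq (u % 3) 2)) n)) none (memCol n (u % 3))) (some (enc n d n)) (mem n m) : Option ℕ) = _
    cases mem n m <;> cases memCol n (u % 3) <;> cases Nat.beq (u % 3) 2 <;> rfl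
  rw [this]
  simp only [cond_eq_ite, mem_iff, memCol_iff, Nat.beq_eq]

/-- The new labels. -/
noncomputable def nl (f : Bool) (s b i : ℕ) : ℕ :=
  if i = 6 then 18 + b else mrg f b (lb s 0) (lb s 5) (lb s i)

theorem step_eq (f : Bool) (s b : ℕ) : step f s b =
    if b = dead s then none else
    fin (dead s) (lb s 0) (nl f s b 0)
      [nl f s b 1, nl f s b 2, nl f s b 3, nl f s b 4, nl f s b 5, nl f s b 6] := by
  have : step f s b = Bool.rec (fin (dead s) (lb s 0) (nl f s b 0)
      [nl f s b 1, nl f s b 2, nl f s b 3, nl f s b 4, nl f s b 5, nl f s b 6])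
      none (Nat.beq b (dead s)) := by
    unfold step
    simp only [force_eq]
    rfl
  rw [this]
  by_cases h : b = dead s
  · rw [if_pos h, ← h]; simp
  · rw [beq_false' h, if_neg h]

/-- The invariant relating a state to a colouring. -/
structure Inv (c : ℕ → ℕ) (n s : ℕ) : Prop where
  lt : ∀ i, i < 6 → lb s i < 18
  col : ∀ i, i < 6 → lb s i % 3 = c (n + i)
  rel : ∀ i j, i < 6 → j < 6 → (lb s i = lb s j ↔ R c n (n + i) (n + j))
  cov : ∀ u, u < n + 6 → (∃ i, i < 6 ∧ R c n u (n + i)) ∨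
    ((c u = 2 ∨ c u = dead s) ∧ ∀ v, v < n + 6 → c v = c u → R c n u v)
  ded : dead s = 2 ∨ ∃ u, u < n + 6 ∧ c u = dead s ∧ ∀ i, i < 6 → ¬ R c n u (n + i)

theorem nl_spec {c : ℕ → ℕ} (hc : Adm c) {n s : ℕ} (h : Inv c n s) (f : Bool)
    (hf : f = true ↔ n % 6 ≠ 0) :
    (∀ i, i ≤ 6 → nl f s (c (n + 6)) i % 3 = c (n + i)) ∧
    (∀ i j, i ≤ 6 → j ≤ 6 → (nl f s (c (n + 6)) i = nl f s (c (n + 6)) j ↔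
      R c (n + 1) (n + i) (n + j))) := by
  classical
  have hb : c (n + 6) < 2 := hc.2 _ (by omega)
  have key : ∀ i, i ≤ 6 → nl f s (c (n + 6)) i =
      if T c n (n + i) then 18 + c (n + 6) else lb s i := by
    intro i hi
    by_cases h6 : i = 6
    · subst h6
      have hT : T c n (n + 6) := Or.inl rfl
      rw [if_pos hT]
      simp [nl]
    · have hi' : i < 6 := by omega
      have hT : ((lb s 0 % 3 = c (n + 6) ∧ lb s i = lb s 0) ∨
          (f = true ∧ lb s 5 % 3 = c (n + 6) ∧ lb s i = lb s 5)) ↔ T c n (n + i) := by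
        rw [hf, h.col 0 (by omega), h.col 5 (by omega),
          h.rel i 0 hi' (by omega), h.rel i 5 hi' (by omega)]
        unfold T
        simp [h6]
      unfold nl
      rw [if_neg h6, mrg_eq]
      by_cases hT' : T c n (n + i)
      · rw [if_pos hT', if_pos (hT.2 hT')]
      · rw [if_neg hT', if_neg (mt hT.1 hT')]
  have hlt : ∀ i, i ≤ 6 → ¬ T c n (n + i) → i < 6 := by
    intro i hi hT
    by_contra h6
    have : i = 6 := by omega
    subst this
    exact hT (Or.inl rfl)
  constructor
  · intro i hi
    rw [key i hi]
    split_ifs with hT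
    · have : R c (n + 1) (n + i) (n + 6) := (R_succ ..).2 (Or.inr ⟨hT, Or.inl rfl⟩)
      rw [R_col hc this]
      omega
    · exact h.col i (hlt i hi hT)
  · intro i j hi hj
    rw [key i hi, key j hj, R_succ]
    split_ifs with h1 h2 h2
    · simp [h1, h2]
    · have := h.lt j (hlt j hj h2)
      constructor
      · intro h; omega
      · rintro (h | h)
        · exact absurd (T_closed h h1) h2
        · exact absurd h.2 h2
    · have := h.lt i (hlt i hi h1)
      constructor
      · intro h; omega
      · rintro (h | h)
        · exact absurd (T_closed (R_symm h) h2) h1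
        · exact absurd h.1 h1
    · rw [h.rel i j (hlt i hi h1) (hlt j hj h2)]
      simp [h1]

theorem inv_next {c : ℕ → ℕ} (hc : Adm c) {n s : ℕ} (h : Inv c n s) (f : Bool)
    (hf : f = true ↔ n % 6 ≠ 0) (d : ℕ) (l : List ℕ)
    (hl : l = [nl f s (c (n + 6)) 1, nl f s (c (n + 6)) 2, nl f s (c (n + 6)) 3,
      nl f s (c (n + 6)) 4, nl f s (c (n + 6)) 5, nl f s (c (n + 6)) 6])
    (hcov : ∀ u, u < n + 7 → (∃ i, i < 6 ∧ R c (n + 1) u (n + 1 + i)) ∨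
      ((c u = 2 ∨ c u = d) ∧ ∀ v, v < n + 7 → c v = c u → R c (n + 1) u v))
    (hded : d = 2 ∨ ∃ u, u < n + 7 ∧ c u = d ∧ ∀ i, i < 6 → ¬ R c (n + 1) u (n + 1 + i)) :
    Inv c (n + 1) (enc l d l) := by
  obtain ⟨k1, k2⟩ := nl_spec hc h f hf
  have hlen : l.length = 6 := by simp [hl]
  have hget : ∀ i, i < 6 → l.getD i 0 = nl f s (c (n + 6)) (i + 1) := by
    intro i hi
    subst hl
    interval_cases i <;> rfl
  have hmem : ∀ i, i < 6 → l.getD i 0 ∈ l := by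
    intro i hi
    subst hl
    interval_cases i <;> simp
  have hlab : ∀ i, i < 6 → lb (enc l d l) i = 3 * idx l (l.getD i 0) + l.getD i 0 % 3 := by
    intro i hi
    exact lb_enc l d l (by omega) (fun _ h => h) i (by omega)
  have hdd : dead (enc l d l) = d := by
    have := dead_enc l d l (by omega) (fun _ h => h)
    rw [hlen] at this
    exact this
  refine ⟨?_, ?_, ?_, ?_, ?_⟩
  · intro i hi
    rw [hlab i hi]
    have := (idx_get l _ (hmem i hi)).1
    omega
  · intro i hi
    rw [hlab i hi]
    have := k1 (i + 1) (by omega)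
    rw [← hget i hi, show n + (i + 1) = n + 1 + i by omega] at this
    omega
  · intro i j hi hj
    have e := k2 (i + 1) (j + 1) (by omega) (by omega)
    rw [← hget i hi, ← hget j hj, show n + (i + 1) = n + 1 + i by omega,
      show n + (j + 1) = n + 1 + j by omega] at e
    rw [← e, hlab i hi, hlab j hj]
    constructor
    · intro h'
      have : idx l (l.getD i 0) = idx l (l.getD j 0) := by omega
      rw [← (idx_get l _ (hmem i hi)).2, ← (idx_get l _ (hmem j hj)).2, this]
    · intro h'
      rw [h']
  · rw [hdd]; exact hcov
  · rw [hdd]; exact hded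

/-- All cells of the same colour are connected. -/
def Good (c : ℕ → ℕ) : Prop := ∀ u v, u < 42 → v < 42 → c u = c v → R c 36 u v

theorem step_spec {c : ℕ → ℕ} (hc : Adm c) {n s : ℕ} (h : Inv c n s) (f : Bool)
    (hf : f = true ↔ n % 6 ≠ 0) (hn : n < 36) :
    (∀ s', step f s (c (n + 6)) = some s' → Inv c (n + 1) s') ∧
    (step f s (c (n + 6)) = none → ¬ Good c) := by
  have hb : c (n + 6) < 2 := hc.2 _ (by omega)
  obtain ⟨k1, k2⟩ := nl_spec hc h f hf
  rw [step_eq]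
  by_cases hd : c (n + 6) = dead s
  · rw [if_pos hd]
    refine ⟨fun s' h => by simp at h, fun _ hG => ?_⟩
    rcases h.ded with h2 | ⟨u, hu, hu1, hu2⟩
    · omega
    · have := hG u (n + 6) (by omega) (by omega) (by omega)
      have h3 := (R_dead hu hu2 (36 - n)).2 (n + 6)
      rw [show n + (36 - n) = 36 by omega] at h3
      rcases R_lt (h3 this) with h | h <;> omega
  rw [if_neg hd, fin_eq]
  generalize hl : [nl f s (c (n + 6)) 1, nl f s (c (n + 6)) 2, nl f s (c (n + 6)) 3,
      nl f s (c (n + 6)) 4, nl f s (c (n + 6)) 5, nl f s (c (n + 6)) 6] = l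
  have hml : ∀ x, x ∈ l ↔ ∃ i, i < 6 ∧ x = nl f s (c (n + 6)) (i + 1) := by
    intro x
    subst hl
    constructor
    · intro hx
      simp only [List.mem_cons, List.not_mem_nil, or_false] at hx
      rcases hx with h | h | h | h | h | h
      · exact ⟨0, by omega, h⟩
      · exact ⟨1, by omega, h⟩
      · exact ⟨2, by omega, h⟩
      · exact ⟨3, by omega, h⟩
      · exact ⟨4, by omega, h⟩
      · exact ⟨5, by omega, h⟩
    · rintro ⟨i, hi, rfl⟩
      interval_cases i <;> simp
  have hm0 : nl f s (c (n + 6)) 0 ∈ l ↔ ∃ i, i < 6 ∧ R c (n + 1) n (n + 1 + i) := by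
    rw [hml]
    refine exists_congr fun i => and_congr_right fun hi => ?_
    rw [k2 0 (i + 1) (by omega) (by omega), show n + (i + 1) = n + 1 + i by omega]
    rfl
  have hmc : (∃ a ∈ l, a % 3 = lb s 0 % 3) ↔ ∃ i, i < 6 ∧ c (n + 1 + i) = c n := by
    rw [h.col 0 (by omega)]
    constructor
    · rintro ⟨a, ha, ha'⟩
      obtain ⟨i, hi, rfl⟩ := (hml a).1 ha
      rw [k1 (i + 1) (by omega)] at ha'
      exact ⟨i, hi, by rw [show n + 1 + i = n + (i + 1) by omega]; exact ha'⟩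
    · rintro ⟨i, hi, hi'⟩
      refine ⟨_, (hml _).2 ⟨i, hi, rfl⟩, ?_⟩
      rw [k1 (i + 1) (by omega), show n + (i + 1) = n + 1 + i by omega]
      exact hi'
  -- every old cell still reaches the frontier, or the dropped cell, or is finished
  have hold : ∀ u, u < n + 7 → (∃ i, i < 6 ∧ R c (n + 1) u (n + 1 + i)) ∨ R c (n + 1) u n ∨
      ((c u = 2 ∨ c u = dead s) ∧ ∀ v, v < n + 7 → c v = c u → R c (n + 1) u v) := by
    intro u hu
    by_cases hu6 : u = n + 6
    · left
      refine ⟨5, by omega, ?_⟩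
      rw [hu6]
      exact R_refl _ _ _
    rcases h.cov u (by omega) with ⟨i, hi, hr⟩ | ⟨h1, h2⟩
    · by_cases hi0 : i = 0
      · subst hi0
        exact Or.inr (Or.inl (Or.inl hr))
      · left
        refine ⟨i - 1, by omega, ?_⟩
        rw [show n + 1 + (i - 1) = n + i by omega]
        exact Or.inl hr
    · right; right
      refine ⟨h1, fun v hv hvu => ?_⟩
      by_cases hv6 : v = n + 6
      · subst hv6
        rcases h1 with h1 | h1
        · rw [hvu, h1] at hb
          exact absurd hb (lt_irrefl 2)
        · exact absurd (hvu.trans h1) hd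
      · exact Or.inl (h2 v (by omega) hvu)
  by_cases hm : nl f s (c (n + 6)) 0 ∈ l
  · rw [if_pos hm]
    refine ⟨?_, by simp⟩
    rintro s' hs'
    rw [Option.some.injEq] at hs'
    subst hs'
    obtain ⟨i, hi, hri⟩ := hm0.1 hm
    refine inv_next hc h f hf _ l hl.symm ?_ ?_
    · intro u hu
      rcases hold u hu with h1 | h1 | h1
      · exact Or.inl h1
      · exact Or.inl ⟨i, hi, R_trans h1 hri⟩
      · exact Or.inr h1
    · rcases h.ded with h1 | ⟨u, hu, hu1, hu2⟩
      · exact Or.inl h1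
      · exact Or.inr ⟨u, by omega, hu1, (R_dead hu hu2 1).1⟩
  rw [if_neg hm]
  have hdead : ∀ i, i < 6 → ¬ R c (n + 1) n (n + 1 + i) := by
    intro i hi hr
    exact hm (hm0.2 ⟨i, hi, hr⟩)
  by_cases hcc : ∃ i, i < 6 ∧ c (n + 1 + i) = c n
  · rw [if_pos (hmc.2 hcc)]
    refine ⟨by simp, fun _ hG => ?_⟩
    obtain ⟨i, hi, hi'⟩ := hcc
    have h3 := (R_dead (by omega : n < n + 1 + 6) hdead (36 - (n + 1))).2 (n + 1 + i)
    rw [show n + 1 + (36 - (n + 1)) = 36 by omega] at h3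
    exact hdead i hi (h3 (hG _ _ (by omega) (by omega) hi'.symm))
  rw [if_neg (mt hmc.1 hcc), h.col 0 (by omega), Nat.add_zero]
  refine ⟨?_, by simp⟩
  rintro s' hs'
  rw [Option.some.injEq] at hs'
  subst hs'
  have hcb : c (n + 6) ≠ c n := by
    intro h'
    exact hcc ⟨5, by omega, h'⟩
  have hcn : c n ≤ 2 := by
    by_cases h6 : n < 6
    · exact (hc.1 n h6).le
    · exact (hc.2 n (by omega)).le
  have hds : dead s = 2 ∨ dead s < 2 := by
    rcases h.ded with h1 | ⟨u, hu, hu1, hu2⟩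
    · exact Or.inl h1
    · rw [← hu1]
      by_cases h6 : u < 6
      · exact Or.inl (hc.1 u h6)
      · exact Or.inr (hc.2 u (by omega))
  -- every cell of the colour of the dropped one is connected to it
  have hall : ∀ v, v < n + 7 → c v = c n → R c (n + 1) v n := by
    intro v hv hvn
    rcases hold v hv with ⟨i, hi, h1⟩ | h1 | ⟨h1, h2⟩
    · exact absurd ⟨i, hi, (R_col hc h1).symm.trans hvn⟩ hcc
    · exact h1
    · exact h2 n (by omega) hvn.symm
  refine inv_next hc h f hf _ l hl.symm ?_ ?_
  · intro u hu
    rcases hold u hu with h1 | h1 | ⟨h1, h2⟩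
    · exact Or.inl h1
    · right
      have hun := R_col hc h1
      constructor
      · split_ifs with h2
        · left; omega
        · right; exact hun
      · intro v hv hvu
        exact R_trans h1 (R_symm (hall v hv (hvu.trans hun)))
    · right
      refine ⟨?_, h2⟩
      split_ifs with h3
      · exact h1
      · clear hm0 hmc hm hold hall hcc
        omega
  · split_ifs with h3
    · rcases h.ded with h1 | ⟨u, hu, hu1, hu2⟩
      · exact Or.inl h1
      · exact Or.inr ⟨u, by omega, hu1, (R_dead hu hu2 1).1⟩
    · exact Or.inr ⟨n, by omega, rfl, hdead⟩

theorem okAll_iff (x : ℕ) (l : List ℕ) :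
    okAll x l = true ↔ ∀ y ∈ l, x % 3 = y % 3 → x = y := by
  induction l with
  | nil => simp [okAll]
  | cons a l ih =>
    simp only [okAll, Bool.and_eq_true, ih, List.mem_cons, forall_eq_or_imp]
    refine and_congr_left fun _ => ?_
    unfold ok
    simp [cond_eq_ite]
    tauto

theorem okPairs_iff (l : List ℕ) :
    okPairs l = true ↔ l.Pairwise fun x y => x % 3 = y % 3 → x = y := by
  induction l with
  | nil => simp [okPairs]
  | cons a l ih => simp only [okPairs, Bool.and_eq_true, ih, okAll_iff, List.pairwise_cons]

theorem acc_iff (s : ℕ) :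
    acc s = true ↔ ∀ i j, i < 6 → j < 6 → lb s i % 3 = lb s j % 3 → lb s i = lb s j := by
  have : acc s = okPairs ((List.range 6).map (lb s)) := rfl
  rw [this, okPairs_iff, List.pairwise_map, List.pairwise_iff_forall_sublist]
  constructor
  · intro h i j hi hj he
    rcases lt_trichotomy i j with hij | hij | hij
    · refine h ?_ he
      interval_cases i <;> interval_cases j <;> first | omega | decide
    · rw [hij]
    · refine (h ?_ he.symm).symm
      interval_cases i <;> interval_cases j <;> first | omega | decide
  · intro h i j hij
    have hi : i ∈ List.range 6 := hij.subset (by simp)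
    have hj : j ∈ List.range 6 := hij.subset (by simp)
    exact h i j (by simpa using hi) (by simpa using hj)

theorem acc_spec {c : ℕ → ℕ} (hc : Adm c) {s : ℕ} (h : Inv c 36 s) : acc s = true ↔ Good c := by
  rw [acc_iff]
  constructor
  · intro ha u v hu hv huv
    rcases h.cov u hu with ⟨i, hi, h1⟩ | ⟨_, h1⟩
    · rcases h.cov v hv with ⟨j, hj, h2⟩ | ⟨_, h2⟩
      · have := ha i j hi hj (by
          rw [h.col i hi, h.col j hj, ← R_col hc h1, ← R_col hc h2, huv])
        exact R_trans h1 (R_trans ((h.rel i j hi hj).1 this) (R_symm h2))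
      · exact R_symm (h2 u hu huv)
    · exact h1 v hv huv.symm
  · intro hG i j hi hj hij
    rw [h.rel i j hi hj]
    rw [h.col i hi, h.col j hj] at hij
    exact hG _ _ (by omega) (by omega) hij

/-- Acceptance of a word. -/
noncomputable def acceptL : List ℕ → ℕ → Bool
  | [], s => acc s
  | b :: w, s => match step (flag (w.length + 1)) s b with
    | none => false
    | some s' => acceptL w s'

theorem accept_spec {c : ℕ → ℕ} (hc : Adm c) (w : List ℕ) (n s : ℕ) (hn : n + w.length = 36)
    (hw : ∀ i, i < w.length → w.getD i 0 = c (n + 6 + i)) (h : Inv c n s) :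
    acceptL w s = true ↔ Good c := by
  induction w generalizing n s with
  | nil =>
    have : n = 36 := by simpa using hn
    subst this
    exact acc_spec hc h
  | cons b w ih =>
    have hb : b = c (n + 6) := by simpa using hw 0 (by simp)
    simp only [List.length_cons] at hn
    subst hb
    have hf : flag (w.length + 1) = true ↔ n % 6 ≠ 0 := by
      unfold flag
      rw [Bool.not_eq_true', ← Bool.not_eq_true, Nat.beq_eq]
      omega
    obtain ⟨h1, h2⟩ := step_spec hc h _ hf (by omega)
    unfold acceptL
    cases hs : step (flag (w.length + 1)) s (c (n + 6)) with
    | none => simpa using h2 hs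
    | some s' =>
      refine ih (n + 1) s' (by omega) ?_ (h1 s' hs)
      intro i hi
      have := hw (i + 1) (by simpa using hi)
      rw [show n + 1 + 6 + i = n + 6 + (i + 1) by omega, ← this]
      simp

theorem inv_init {c : ℕ → ℕ} (hc : Adm c) : Inv c 0 s0 := by
  have hm : ∀ a ∈ [2, 2, 2, 2, 2, 2], a ∈ [2, 2, 2, 2, 2, 2] := fun _ h => h
  have hl : ∀ i, i < 6 → lb s0 i = 2 := by
    intro i hi
    unfold s0
    rw [lb_enc _ _ _ (by simp) hm i hi]
    interval_cases i <;> rfl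
  have hd : dead s0 = 2 := dead_enc _ _ _ (by simp) hm
  refine ⟨?_, ?_, ?_, ?_, Or.inl hd⟩
  · intro i hi; rw [hl i hi]; omega
  · intro i hi; rw [hl i hi, hc.1 (0 + i) (by omega)]
  · intro i j hi hj
    rw [hl i hi, hl j hj]
    simp [R, hi, hj]
  · intro u hu
    exact Or.inl ⟨0, by omega, Or.inr ⟨hu, by omega⟩⟩

/-! ### The computation -/

/-- Weighted sum over a tree. -/
def wsum (F : ℕ → ℕ) : Tr → ℕ
  | .leaf => 0
  | .node l k v r => wsum F l + v * F k + wsum F r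

theorem ins_spec (t : Tr) (k v : ℕ) : ∃ t', (∀ K, ins t k v K = K t') ∧
    ∀ F, wsum F t' = wsum F t + v * F k := by
  induction t with
  | leaf => exact ⟨.node .leaf k v .leaf, fun K => rfl, fun F => by simp [wsum]⟩
  | node l k' v' r il ir =>
    obtain ⟨l', hl, hl'⟩ := il
    obtain ⟨r', hr, hr'⟩ := ir
    have e : ∀ K, ins (.node l k' v' r) k v K =
        bif Nat.beq k k' then force (v' + v) fun v'' => K (.node l k' v'' r)
        else bif Nat.ble k k' then ins l k v fun l' => K (.node l' k' v' r)
        else ins r k v fun r' => K (.node l k' v' r') := by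
      intro K
      change (Bool.rec (Bool.rec (ins r k v fun r' => K (.node l k' v' r'))
        (ins l k v fun l' => K (.node l' k' v' r)) (Nat.ble k k'))
        (force (v' + v) fun v'' => K (.node l k' v'' r)) (Nat.beq k k') : ℕ) = _
      cases Nat.beq k k' <;> cases Nat.ble k k' <;> rfl
    simp only [force_eq, hl, hr] at e
    cases h1 : Nat.beq k k' with
    | true =>
      have : k = k' := Nat.eq_of_beq_eq_true h1
      subst this
      refine ⟨.node l k (v' + v) r, fun K => by rw [e, h1]; rfl, fun F => ?_⟩
      simp only [wsum]; ring
    | false =>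
      cases h2 : Nat.ble k k' with
      | true =>
        refine ⟨.node l' k' v' r, fun K => by rw [e, h1, h2]; rfl, fun F => ?_⟩
        simp only [wsum, hl']; ring
      | false =>
        refine ⟨.node l k' v' r', fun K => by rw [e, h1, h2]; rfl, fun F => ?_⟩
        simp only [wsum, hr']; ring

/-- Extend a function by zero on failures. -/
def ext0 (F : ℕ → ℕ) : Option ℕ → ℕ
  | none => 0
  | some s => F s

theorem put_spec (o : Option ℕ) (v : ℕ) (t : Tr) : ∃ t', (∀ K, put o v t K = K t') ∧
    ∀ F, wsum F t' = wsum F t + v * ext0 F o := by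
  cases o with
  | none => exact ⟨t, fun K => rfl, fun F => by simp [ext0]⟩
  | some s =>
    obtain ⟨t', h1, h2⟩ := ins_spec t s v
    refine ⟨t', fun K => ?_, h2⟩
    have : put (some s) v t K = force s fun s => force v fun v => ins t s v K := rfl
    rw [this]
    simp only [force_eq, h1]

theorem expand_spec (f : Bool) (t a : Tr) : ∃ t', (∀ K, expand f t a K = K t') ∧
    ∀ F, wsum F t' = wsum F a +
      wsum (fun s => ext0 F (step f s 0) + X * ext0 F (step f s 1)) t := by
  induction t generalizing a with
  | leaf => exact ⟨a, fun K => rfl, fun F => by simp [wsum]⟩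
  | node l k v r il ir =>
    obtain ⟨a1, h1, h1'⟩ := put_spec (step f k 0) v a
    obtain ⟨a2, h2, h2'⟩ := put_spec (step f k 1) (v * X) a1
    obtain ⟨a3, h3, h3'⟩ := il a2
    obtain ⟨a4, h4, h4'⟩ := ir a3
    refine ⟨a4, fun K => ?_, fun F => ?_⟩
    · have : expand f (.node l k v r) a K = put (step f k 0) v a fun a =>
        put (step f k 1) (v * X) a fun a => expand f l a fun a => expand f r a K := rfl
      rw [this]
      simp only [h1, h2, h3, h4]
    · rw [h4', h3', h2', h1']
      simp only [wsum]
      ring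

/-- Weight of all accepted continuations of length `m`. -/
noncomputable def W (m s : ℕ) : ℕ :=
  ∑ g : Fin m → Fin 2, X ^ (∑ i, (g i : ℕ)) *
    (if acceptL (List.ofFn fun i => (g i : ℕ)) s = true then 1 else 0)

theorem W_succ (m s : ℕ) : W (m + 1) s =
    ext0 (W m) (step (flag (m + 1)) s 0) + X * ext0 (W m) (step (flag (m + 1)) s 1) := by
  unfold W
  rw [← (Fin.consEquiv fun _ : Fin (m + 1) => Fin 2).sum_comp, Fintype.sum_prod_type,
    Fin.sum_univ_two]
  have key : ∀ b : Fin 2, (∑ g : Fin m → Fin 2,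
      X ^ (∑ i, ((Fin.consEquiv fun _ : Fin (m + 1) => Fin 2) (b, g) i : ℕ)) *
      (if acceptL (List.ofFn fun i =>
        ((Fin.consEquiv fun _ : Fin (m + 1) => Fin 2) (b, g) i : ℕ)) s = true then 1 else 0)) =
      X ^ (b : ℕ) * ext0 (W m) (step (flag (m + 1)) s b) := by
    intro b
    simp only [Fin.consEquiv, Equiv.coe_fn_mk, Fin.sum_univ_succ, Fin.cons_zero, Fin.cons_succ,
      List.ofFn_succ, acceptL, List.length_ofFn]
    cases step (flag (m + 1)) s b with
    | none => simp [ext0]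
    | some s' =>
      simp only [ext0, W, Finset.mul_sum]
      refine Finset.sum_congr rfl fun g _ => ?_
      rw [pow_add, mul_assoc]
  rw [key 0, key 1]
  simp [ext0, W]

theorem run_spec (m : ℕ) (t : Tr) : run m t = wsum (W m) t := by
  induction m generalizing t with
  | zero =>
    have : ∀ t, total t = wsum (W 0) t := by
      intro t
      induction t with
      | leaf => rfl
      | node l k v r hl hr =>
        have hW : W 0 k = if acc k = true then 1 else 0 := by simp [W, acceptL]
        rw [total, wsum, hl, hr, hW]
        cases acc k <;> simp
    exact this t
  | succ m ih =>
    obtain ⟨t', h1, h2⟩ := expand_spec (flag (m + 1)) t .leaf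
    have : run (m + 1) t = expand (flag (m + 1)) t .leaf fun t' => run m t' := rfl
    rw [this, h1, ih, h2]
    simp only [wsum, zero_add, ← W_succ]

/-- Extracting a digit. -/
theorem digit (B : ℕ) (a : ℕ → ℕ) (ha : ∀ i, a i < B) (k m : ℕ) (hk : k < m) :
    (∑ i ∈ Finset.range m, a i * B ^ i) / B ^ k % B = a k := by
  have hB : 0 < B := lt_of_le_of_lt (Nat.zero_le _) (ha 0)
  have low : ∀ k, ∑ i ∈ Finset.range k, a i * B ^ i < B ^ k := by
    intro k
    induction k with
    | zero => simp
    | succ k ih =>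
      rw [Finset.sum_range_succ, pow_succ]
      have : (a k + 1) * B ^ k ≤ B * B ^ k := Nat.mul_le_mul_right _ (ha k)
      nlinarith
  have high : ∀ m, ∃ q, ∑ i ∈ Finset.range (k + 1 + m), a i * B ^ i =
      ∑ i ∈ Finset.range k, a i * B ^ i + (a k + B * q) * B ^ k := by
    intro m
    induction m with
    | zero => exact ⟨0, by rw [Nat.add_zero, Finset.sum_range_succ]; simp⟩
    | succ m ih =>
      obtain ⟨q, hq⟩ := ih
      refine ⟨q + a (k + 1 + m) * B ^ m, ?_⟩
      rw [← Nat.add_assoc, Finset.sum_range_succ, hq]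
      ring
  obtain ⟨q, hq⟩ := high (m - (k + 1))
  rw [show k + 1 + (m - (k + 1)) = m by omega] at hq
  rw [hq, Nat.add_mul_div_right _ _ (pow_pos hB k), Nat.div_eq_of_lt (low k), zero_add,
    Nat.add_mul_mod_self_left, Nat.mod_eq_of_lt (ha k)]

/-- The accepted words with a given number of ones. -/
noncomputable def words (m s k : ℕ) : Finset (Fin m → Fin 2) :=
  Finset.univ.filter fun g =>
    (∑ i, (g i : ℕ)) = k ∧ acceptL (List.ofFn fun i => (g i : ℕ)) s = true

theorem W_digits (m s : ℕ) :
    W m s = ∑ k ∈ Finset.range (m + 1), (words m s k).card * X ^ k := by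
  unfold W
  rw [← Finset.sum_fiberwise_of_maps_to (s := Finset.univ) (t := Finset.range (m + 1))
    (g := fun g : Fin m → Fin 2 => ∑ i, (g i : ℕ))]
  · refine Finset.sum_congr rfl fun k _ => ?_
    rw [words, ← Finset.filter_filter, Finset.card_filter, Finset.sum_mul]
    refine Finset.sum_congr rfl fun g hg => ?_
    rw [(Finset.mem_filter.1 hg).2, mul_comm]
  · intro g _
    rw [Finset.mem_range]
    have : ∑ i, (g i : ℕ) ≤ ∑ i : Fin m, 1 := Finset.sum_le_sum fun i _ => by omega
    simp at this
    omega

theorem run_digit (m s k : ℕ) (hm : 2 ^ m < X) (hk : k < m + 1) :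
    run m (.node .leaf s 1 .leaf) / X ^ k % X = (words m s k).card := by
  rw [run_spec]
  simp only [wsum, one_mul, zero_add, add_zero]
  rw [W_digits]
  refine digit X (fun k => (words m s k).card) (fun k => ?_) k (m + 1) hk
  calc (words m s k).card ≤ (Finset.univ : Finset (Fin m → Fin 2)).card :=
        Finset.card_filter_le _ _
    _ = 2 ^ m := by simp
    _ < X := hm

theorem X_large : 2 ^ 36 < X := by
  unfold X
  norm_num

theorem beq_trans (m s k N : ℕ) (hm : 2 ^ m < X) (hk : k < m + 1)
    (h : Nat.beq (run m (.node .leaf s 1 .leaf) / X ^ k % X) N = true) :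
    (words m s k).card = N :=
  (run_digit m s k hm hk).symm.trans (Nat.eq_of_beq_eq_true h)

theorem lt_aux : 18 < 36 + 1 := by omega

theorem card_words_aux (s : ℕ)
    (h : Nat.beq (run 36 (.node .leaf s 1 .leaf) / X ^ 18 % X) 161036 = true) :
    (words 36 s 18).card = 161036 :=
  beq_trans 36 s 18 161036 X_large lt_aux h

theorem card_words : (words 36 s0 18).card = 161036 := card_words_aux s0 computation

/-! ### Colourings and regions -/

/-- The colouring of a word. -/
def colr (g : Fin 36 → Fin 2) (x : ℕ) : ℕ :=
  if x < 6 then 2 else if h : x - 6 < 36 then (g ⟨x - 6, h⟩ : ℕ) else 0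

theorem colr_adm (g : Fin 36 → Fin 2) : Adm (colr g) := by
  constructor
  · intro x hx; simp [colr, hx]
  · intro x hx
    unfold colr
    rw [if_neg (by omega)]
    split_ifs <;> omega

theorem accept_good (g : Fin 36 → Fin 2) :
    acceptL (List.ofFn fun i => (g i : ℕ)) s0 = true ↔ Good (colr g) := by
  refine accept_spec (colr_adm g) _ 0 s0 (by simp) ?_ (inv_init (colr_adm g))
  intro i hi
  have hi' : i < 36 := by rwa [List.length_ofFn] at hi
  have h6 : ¬ (0 + 6 + i < 6) := by omega
  have h7 : 0 + 6 + i - 6 = i := by omega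
  rw [List.getD_eq_getElem _ _ hi]
  rw [List.getElem_ofFn]
  unfold colr
  rw [if_neg h6, dif_pos (by omega)]
  simp only [h7]

/-- The word of a region. -/
def word (S : Finset (Fin 6 × Fin 6)) (i : Fin 36) : Fin 2 :=
  if (finProdFinEquiv (m := 6) (n := 6)).symm i ∈ S then 1 else 0

/-- The cell number of a cell of the board. -/
def code (p : Fin 6 × Fin 6) : ℕ := p.2 + 6 * p.1 + 6

theorem code_inj {p q : Fin 6 × Fin 6} (h : code p = code q) : p = q := by
  obtain ⟨a, b⟩ := p
  obtain ⟨a', b'⟩ := q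
  simp only [code] at h
  ext <;> simp <;> omega

theorem code_surj (x : ℕ) (h1 : 6 ≤ x) (h2 : x < 42) : ∃ p, code p = x :=
  ⟨(⟨(x - 6) / 6, by omega⟩, ⟨(x - 6) % 6, by omega⟩), by simp only [code]; omega⟩

theorem code_lt (p : Fin 6 × Fin 6) : 6 ≤ code p ∧ code p < 42 := by
  unfold code; omega

theorem colr_code (S : Finset (Fin 6 × Fin 6)) (p : Fin 6 × Fin 6) :
    colr (word S) (code p) = if p ∈ S then 1 else 0 := by
  have h := code_lt p
  unfold colr
  rw [if_neg (by omega), dif_pos (by omega : code p - 6 < 36)]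
  have e : (⟨code p - 6, by omega⟩ : Fin 36) = finProdFinEquiv (m := 6) (n := 6) p := by
    ext
    simp [code, finProdFinEquiv]
  rw [e]
  unfold word
  rw [Equiv.symm_apply_apply]
  split_ifs <;> rfl

theorem colr_code_eq (S : Finset (Fin 6 × Fin 6)) (p q : Fin 6 × Fin 6) :
    colr (word S) (code p) = colr (word S) (code q) ↔ (p ∈ S ↔ q ∈ S) := by
  rw [colr_code, colr_code]
  by_cases h1 : p ∈ S <;> by_cases h2 : q ∈ S <;> simp [h1, h2]

/-- The graph joining adjacent cells of the same colour. -/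
def H (S : Finset (Fin 6 × Fin 6)) : SimpleGraph (Fin 6 × Fin 6) where
  Adj p q := (gridGraph 6 6).Adj p q ∧ (p ∈ S ↔ q ∈ S)
  symm := ⟨fun _ _ h => ⟨h.1.symm, h.2.symm⟩⟩
  loopless := ⟨fun _ h => h.1.ne rfl⟩

theorem grid_adj (p q : Fin 6 × Fin 6) : (gridGraph 6 6).Adj p q ↔
    (code q = code p + 6 ∨ (code q = code p + 1 ∧ code q % 6 ≠ 0)) ∨
    (code p = code q + 6 ∨ (code p = code q + 1 ∧ code p % 6 ≠ 0)) := by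
  obtain ⟨a, b⟩ := p
  obtain ⟨a', b'⟩ := q
  simp only [gridGraph, SimpleGraph.fromRel_adj, code, ne_eq, Prod.mk.injEq, Fin.ext_iff]
  omega

theorem R_of_adj (S : Finset (Fin 6 × Fin 6)) (p q : Fin 6 × Fin 6) (h : (H S).Adj p q) :
    R (colr (word S)) 36 (code p) (code q) := by
  have key : ∀ p q : Fin 6 × Fin 6, (p ∈ S ↔ q ∈ S) →
      (code q = code p + 6 ∨ (code q = code p + 1 ∧ code q % 6 ≠ 0)) →
      R (colr (word S)) 36 (code p) (code q) := by
    intro p q hpq h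
    have hp := code_lt p
    have hq := code_lt q
    have hc := (colr_code_eq S p q).2 hpq
    obtain ⟨n, hn⟩ : ∃ n, code q = n + 6 := ⟨code q - 6, by omega⟩
    have : R (colr (word S)) (n + 1) (code p) (code q) := by
      rw [R_succ]
      right
      refine ⟨?_, Or.inl hn⟩
      rw [hn] at hc h
      rcases h with h | h
      · have : code p = n := by omega
        rw [this] at hc ⊢
        exact Or.inr (Or.inl ⟨hc, R_refl _ _ _⟩)
      · have : code p = n + 5 := by omega
        rw [this] at hc ⊢
        exact Or.inr (Or.inr ⟨by omega, hc, R_refl _ _ _⟩)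
    have := R_mono (36 - (n + 1)) this
    rwa [show n + 1 + (36 - (n + 1)) = 36 by omega] at this
  rcases (grid_adj p q).1 h.1 with h' | h'
  · exact key p q h.2 h'
  · exact R_symm (key q p h.2.symm h')

theorem R_iff (S : Finset (Fin 6 × Fin 6)) (p q : Fin 6 × Fin 6) :
    R (colr (word S)) 36 (code p) (code q) ↔ (H S).Reachable p q := by
  constructor
  · intro h
    let Q : ℕ → ℕ → Prop := fun x y => x = y ∨ (x < 6 ∧ y < 6) ∨
      ∃ p q, code p = x ∧ code q = y ∧ (H S).Reachable p q
    have hQ : ∀ p q, (H S).Adj p q → Q (code p) (code q) :=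
      fun p q h => Or.inr (Or.inr ⟨p, q, rfl, rfl, h.reachable⟩)
    have : Q (code p) (code q) := by
      refine R_min (colr (word S)) Q (fun _ => Or.inl rfl) ?_ ?_ ?_ 36 ?_ ?_ 36 le_rfl _ _ h
      · rintro x y (h | h | ⟨p, q, hp, hq, h⟩)
        · exact Or.inl h.symm
        · exact Or.inr (Or.inl h.symm)
        · exact Or.inr (Or.inr ⟨q, p, hq, hp, h.symm⟩)
      · rintro x y z (h | h | ⟨p, q, hp, hq, h⟩) (h' | h' | ⟨p', q', hp', hq', h'⟩)
        · exact Or.inl (h.trans h')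
        · exact Or.inr (Or.inl (h ▸ h'))
        · exact Or.inr (Or.inr ⟨p', q', hp'.trans h.symm, hq', h'⟩)
        · exact Or.inr (Or.inl (h' ▸ h))
        · exact Or.inr (Or.inl ⟨h.1, h'.2⟩)
        · have := code_lt p'; omega
        · exact Or.inr (Or.inr ⟨p, q, hp, hq.trans h', h⟩)
        · have := code_lt q; omega
        · have : q = p' := code_inj (hq.trans hp'.symm)
          subst this
          exact Or.inr (Or.inr ⟨p, q', hp, hq', h.trans h'⟩)
      · intro x y hx hy
        exact Or.inr (Or.inl ⟨hx, hy⟩)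
      · intro n hn hc
        by_cases h6 : n < 6
        · have h1 := (colr_adm (word S)).1 n h6
          have h2 := (colr_adm (word S)).2 (n + 6) (by omega)
          omega
        obtain ⟨p, hp⟩ := code_surj n (by omega) (by omega)
        obtain ⟨q, hq⟩ := code_surj (n + 6) (by omega) (by omega)
        rw [← hq, ← hp]
        refine hQ p q ⟨(grid_adj p q).2 (by omega), (colr_code_eq S p q).1 ?_⟩
        rw [hp, hq, hc]
      · intro n hn hn6 hc
        obtain ⟨p, hp⟩ := code_surj (n + 5) (by omega) (by omega)
        obtain ⟨q, hq⟩ := code_surj (n + 6) (by omega) (by omega)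
        rw [← hq, ← hp]
        refine hQ p q ⟨(grid_adj p q).2 (by omega), (colr_code_eq S p q).1 ?_⟩
        rw [hp, hq, hc]
    rcases this with h | h | ⟨p', q', hp, hq, h⟩
    · rw [code_inj h]
    · have := code_lt p; omega
    · rw [← code_inj hp, ← code_inj hq]; exact h
  · rintro ⟨w⟩
    induction w with
    | nil => exact R_refl _ _ _
    | cons h _ ih => exact R_trans (R_of_adj S _ _ h) ih

theorem reach_induce (S A : Finset (Fin 6 × Fin 6))
    (hA : ∀ p q, p ∈ A → ((q ∈ A) ↔ (p ∈ S ↔ q ∈ S))) (p q : Fin 6 × Fin 6) (hp : p ∈ A)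
    (hq : q ∈ A) : (H S).Reachable p q ↔
    ((gridGraph 6 6).induce (A : Set (Fin 6 × Fin 6))).Reachable ⟨p, hp⟩ ⟨q, hq⟩ := by
  constructor
  · rintro ⟨w⟩
    induction w with
    | nil => exact SimpleGraph.Reachable.refl _
    | @cons u v w h _ ih =>
      have hv : v ∈ A := (hA u v hp).2 h.2
      refine SimpleGraph.Reachable.trans (SimpleGraph.Adj.reachable ?_) (ih hv hq)
      exact h.1
  · intro h
    let φ : ((gridGraph 6 6).induce (A : Set (Fin 6 × Fin 6))) →g H S :=
      ⟨fun x => x.1, fun {a b} hab => ⟨hab, (hA a.1 b.1 a.2).1 b.2⟩⟩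
    exact h.map φ

theorem connected_iff (S A : Finset (Fin 6 × Fin 6)) (hne : A.Nonempty)
    (hA : ∀ p q, p ∈ A → ((q ∈ A) ↔ (p ∈ S ↔ q ∈ S))) :
    ConnectedRegion 6 6 A ↔ ∀ p ∈ A, ∀ q ∈ A, (H S).Reachable p q := by
  unfold ConnectedRegion
  rw [SimpleGraph.connected_iff]
  constructor
  · rintro ⟨h, _⟩ p hp q hq
    exact (reach_induce S A hA p q hp hq).2 (h _ _)
  · intro h
    refine ⟨?_, ?_⟩
    · rintro ⟨p, hp⟩ ⟨q, hq⟩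
      exact (reach_induce S A hA p q hp hq).1 (h p hp q hq)
    · obtain ⟨p, hp⟩ := hne
      exact ⟨⟨p, hp⟩⟩

theorem good_iff (S : Finset (Fin 6 × Fin 6)) (hS : S.card = 18) :
    Good (colr (word S)) ↔ ConnectedRegion 6 6 S ∧ ConnectedRegion 6 6 Sᶜ := by
  have h1 : S.Nonempty := by rw [← Finset.card_pos]; omega
  have h2 : Sᶜ.Nonempty := by
    rw [← Finset.card_pos, Finset.card_compl, hS]
    simp
  rw [connected_iff S S h1 (fun p q hp => by simp [hp]),
    connected_iff S Sᶜ h2 (fun p q hp => by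
      rw [Finset.mem_compl] at hp
      simp [hp])]
  constructor
  · intro h
    constructor
    · intro p hp q hq
      rw [← R_iff]
      exact h _ _ (code_lt p).2 (code_lt q).2 ((colr_code_eq S p q).2 (by simp [hp, hq]))
    · intro p hp q hq
      rw [Finset.mem_compl] at hp hq
      rw [← R_iff]
      exact h _ _ (code_lt p).2 (code_lt q).2 ((colr_code_eq S p q).2 (by simp [hp, hq]))
  · rintro ⟨h, h'⟩ u v hu hv huv
    have hc := colr_adm (word S)
    by_cases hu6 : u < 6
    · have h3 := hc.1 u hu6
      exact R_two hc h3 (huv ▸ h3)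
    by_cases hv6 : v < 6
    · have h3 := hc.1 v hv6
      exact R_two hc (huv.trans h3) h3
    obtain ⟨p, rfl⟩ := code_surj u (by omega) hu
    obtain ⟨q, rfl⟩ := code_surj v (by omega) hv
    rw [colr_code_eq] at huv
    rw [R_iff]
    by_cases hp : p ∈ S
    · exact h p hp q (huv.1 hp)
    · exact h' p (by simpa using hp) q (by simpa using mt huv.2 hp)

/-- Regions are words. -/
noncomputable def wordEquiv : Finset (Fin 6 × Fin 6) ≃ (Fin 36 → Fin 2) where
  toFun := word
  invFun g := Finset.univ.filter fun p => g (finProdFinEquiv (m := 6) (n := 6) p) = 1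
  left_inv S := by
    ext p
    simp [word]
  right_inv g := by
    funext i
    simp only [word, Finset.mem_filter, Finset.mem_univ, true_and, Equiv.apply_symm_apply]
    split_ifs with h
    · exact h.symm
    · omega

theorem card_word (S : Finset (Fin 6 × Fin 6)) : (∑ i, (word S i : ℕ)) = S.card := by
  rw [← (finProdFinEquiv (m := 6) (n := 6)).sum_comp]
  have : ∀ p : Fin 6 × Fin 6, (word S (finProdFinEquiv (m := 6) (n := 6) p) : ℕ) =
      if p ∈ S then 1 else 0 := by
    intro p
    unfold word
    rw [Equiv.symm_apply_apply]
    split_ifs <;> rfl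
  simp only [this]
  simp

end GM

theorem gerrymander_count_6x6 :
    Nat.card {S : Finset (Fin 6 × Fin 6) //
      S.card = 18 ∧ ConnectedRegion 6 6 S ∧ ConnectedRegion 6 6 Sᶜ} = 161036 := by
  rw [← GM.card_words, ← Nat.card_eq_finsetCard]
  refine Nat.card_congr (GM.wordEquiv.subtypeEquiv fun S => ?_)
  have h1 : GM.wordEquiv S = GM.word S := rfl
  rw [h1, GM.words, Finset.mem_filter, GM.card_word, GM.accept_good]
  simp only [Finset.mem_univ, true_and]
  exact and_congr_right fun h => (GM.good_iff S h).symm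
end
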